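/- Let B_1, ..., B_M ∈ ℝ^{N×N}, let N₀ := ∑_{m=1}^M B_m B_mᵀ, and let λ_1(N₀) ≥ ... ≥ λ_N(N₀) be the eigenvalues of N₀ in nonincreasing order with multiplicity. Let U ∈ ℝ^{N×k} be a matrix whose columns are orthonormal eigenvectors of N₀ associated with its k largest eigenvalues, and set V_m := B_mᵀ U for each m. Then for every matrix U' ∈ ℝ^{N×k} with U'ᵀU' = I_k and every family V'_1, ..., V'_M ∈ ℝ^{N×k}, ∑_{m=1}^M ‖B_m − U V_mᵀ‖_F² ≤ ∑_{m=1}^M ‖B_m − U' V'_mᵀ‖_F²; i.e., this U together with V_m = B_mᵀU solves the generalized low-rank approximation problem min_{UᵀU = I_k, V_m} ∑_{m=1}^M ‖B_m − U V_mᵀ‖_F². -/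

import Mathlib

open Matrix BigOperators

/-- Squared Frobenius norm of a real matrix: `‖A‖_F² = tr (A * Aᵀ)`. -/
noncomputable def frobSq {n m : ℕ} (A : Matrix (Fin n) (Fin m) ℝ) : ℝ :=
  Matrix.trace (A * Aᵀ)

theorem frobSq_nonneg {n m : ℕ} (A : Matrix (Fin n) (Fin m) ℝ) : 0 ≤ frobSq A := by
  simp only [frobSq, trace, diag_apply, mul_apply, transpose_apply]
  exact Finset.sum_nonneg fun i _ => Finset.sum_nonneg fun j _ => mul_self_nonneg _

/-- Completing the square in the second factor of a low-rank approximation. -/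
theorem frobSq_sub_mul_transpose {n m k : ℕ} (B : Matrix (Fin n) (Fin m) ℝ)
    (U : Matrix (Fin n) (Fin k) ℝ) (V : Matrix (Fin m) (Fin k) ℝ) (hU : Uᵀ * U = 1) :
    frobSq (B - U * Vᵀ) = frobSq B - trace (Uᵀ * (B * Bᵀ) * U) + frobSq (V - Bᵀ * U) := by
  have hcross : trace (U * Vᵀ * Bᵀ) = trace (B * V * Uᵀ) := by
    rw [← trace_transpose]
    simp [Matrix.mul_assoc]
  have hcross' : trace (V * (Uᵀ * B)) = trace (B * V * Uᵀ) := by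
    rw [← Matrix.mul_assoc, trace_mul_comm, Matrix.mul_assoc]
  have hcross'' : trace (Bᵀ * U * Vᵀ) = trace (B * V * Uᵀ) := by
    rw [Matrix.mul_assoc, trace_mul_comm, hcross]
  have hquad : trace (U * Vᵀ * (V * Uᵀ)) = trace (V * Vᵀ) := by
    rw [trace_mul_comm, Matrix.mul_assoc, ← Matrix.mul_assoc Uᵀ, hU, Matrix.one_mul]
  have hproj : trace (Bᵀ * U * (Uᵀ * B)) = trace (Uᵀ * (B * Bᵀ) * U) := by
    rw [trace_mul_comm]
    simp only [Matrix.mul_assoc]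
  simp only [frobSq, transpose_sub, transpose_mul, transpose_transpose, Matrix.sub_mul,
    Matrix.mul_sub, trace_sub, hquad, hproj, hcross, hcross', hcross'', ← Matrix.mul_assoc B V]
  ring

/-- A weighted sum of nonincreasing reals with weights in `[0, 1]` of total mass `k` is at most
the sum of the `k` largest. -/
theorem sum_mul_le_sum_castLE {N k : ℕ} (hk : k ≤ N) {lam p : Fin N → ℝ} (hlam : Antitone lam)
    (hp0 : ∀ i, 0 ≤ p i) (hp1 : ∀ i, p i ≤ 1) (hp : ∑ i, p i = k) :
    ∑ i, lam i * p i ≤ ∑ j : Fin k, lam (Fin.castLE hk j) := by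
  obtain ⟨c, hc1, hc2⟩ : ∃ c, (∀ i : Fin N, i.val < k → c ≤ lam i) ∧
      ∀ i : Fin N, k ≤ i.val → lam i ≤ c := by
    rcases Nat.eq_zero_or_pos N with rfl | hN
    · exact ⟨0, fun i => i.elim0, fun i => i.elim0⟩
    · refine ⟨lam ⟨k - 1, by lia⟩, fun i hi => hlam ?_, fun i hi => hlam ?_⟩ <;>
        simp only [Fin.le_def] <;> lia
  obtain ⟨d, rfl⟩ := Nat.exists_eq_add_of_le hk
  change _ ≤ ∑ j : Fin k, lam (Fin.castAdd d j)
  rw [Fin.sum_univ_add] at hp ⊢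
  have hhead : ∑ j : Fin k, lam (Fin.castAdd d j) * p (Fin.castAdd d j) ≤
      ∑ j : Fin k, (lam (Fin.castAdd d j) - c + c * p (Fin.castAdd d j)) :=
    Finset.sum_le_sum fun j _ => by
      nlinarith [mul_nonneg (sub_nonneg.2 (hc1 (Fin.castAdd d j) (by simp)))
        (sub_nonneg.2 (hp1 (Fin.castAdd d j)))]
  have htail : ∑ j : Fin d, lam (Fin.natAdd k j) * p (Fin.natAdd k j) ≤
      ∑ j : Fin d, c * p (Fin.natAdd k j) :=
    Finset.sum_le_sum fun j _ => mul_le_mul_of_nonneg_right (hc2 _ (by simp)) (hp0 _)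
  simp only [Finset.sum_add_distrib, Finset.sum_sub_distrib, ← Finset.mul_sum, Finset.sum_const,
    Finset.card_univ, Fintype.card_fin, nsmul_eq_mul] at hhead htail
  linear_combination hhead + htail + c * hp

/-- The diagonal entries of the projection `W * Wᵀ` are at most `1`. -/
theorem mul_transpose_apply_self_le_one {N k : ℕ} {W : Matrix (Fin N) (Fin k) ℝ}
    (hW : Wᵀ * W = 1) (i : Fin N) : (W * Wᵀ) i i ≤ 1 := by
  have hidem : (W * Wᵀ) * (W * Wᵀ)ᵀ = W * Wᵀ := by
    rw [transpose_mul, transpose_transpose, Matrix.mul_assoc, ← Matrix.mul_assoc Wᵀ, hW,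
      Matrix.one_mul]
  have hsq : (W * Wᵀ) i i * (W * Wᵀ) i i ≤ (W * Wᵀ) i i := by
    conv_rhs => rw [← hidem, mul_apply]
    exact Finset.single_le_sum (f := fun j => (W * Wᵀ) i j * (W * Wᵀ)ᵀ j i)
      (fun j _ => mul_self_nonneg _) (Finset.mem_univ i)
  nlinarith

/-- Ky Fan's inequality for a diagonal matrix. -/
theorem trace_transpose_mul_diagonal_mul_le {N k : ℕ} (hk : k ≤ N) {lam : Fin N → ℝ}
    (hlam : Antitone lam) {W : Matrix (Fin N) (Fin k) ℝ} (hW : Wᵀ * W = 1) :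
    trace (Wᵀ * diagonal lam * W) ≤ ∑ j : Fin k, lam (Fin.castLE hk j) := by
  have htrace : trace (Wᵀ * diagonal lam * W) = ∑ i, lam i * (W * Wᵀ) i i := by
    rw [Matrix.mul_assoc, trace_mul_comm, Matrix.mul_assoc]
    simp [trace, diagonal_mul]
  rw [htrace]
  refine sum_mul_le_sum_castLE hk hlam (fun i => ?_) (mul_transpose_apply_self_le_one hW) ?_
  · simp only [mul_apply, transpose_apply]
    exact Finset.sum_nonneg fun j _ => mul_self_nonneg _
  · change trace (W * Wᵀ) = k
    rw [trace_mul_comm, hW, trace_one, Fintype.card_fin]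

/-- Optimality of the GLRAM solution: let `N₀ = ∑ₘ Bₘ Bₘᵀ` have eigenvalues
`λ₁ ≥ … ≥ λ_N` (with multiplicity, encoded by an orthogonal diagonalization
`N₀ = Q (diag λ) Qᵀ` with `λ` nonincreasing).  If the columns of `U` are
orthonormal eigenvectors of `N₀` for its `k` largest eigenvalues
(i.e. `Uᵀ U = I_k` and `N₀ U = U diag(λ₁,…,λ_k)`), and `Vₘ = Bₘᵀ U`, then
`U, (Vₘ)` minimize `∑ₘ ‖Bₘ − U' V'ₘᵀ‖_F²` over all `U'` with `U'ᵀU' = I_k`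
and all families `V'₁, …, V'_M`. -/
theorem stmt8 {M N k : ℕ} (hk : k ≤ N)
    (B : Fin M → Matrix (Fin N) (Fin N) ℝ)
    (lam : Fin N → ℝ) (hlam : Antitone lam)
    (Q : Matrix (Fin N) (Fin N) ℝ) (hQ : Qᵀ * Q = 1)
    (hdecomp : (∑ m : Fin M, B m * (B m)ᵀ) = Q * Matrix.diagonal lam * Qᵀ)
    (U : Matrix (Fin N) (Fin k) ℝ)
    (hU : Uᵀ * U = 1)
    (hUeig : (∑ m : Fin M, B m * (B m)ᵀ) * U
      = U * Matrix.diagonal (fun j : Fin k => lam (Fin.castLE hk j)))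
    (V : Fin M → Matrix (Fin N) (Fin k) ℝ)
    (hV : ∀ m, V m = (B m)ᵀ * U) :
    ∀ (U' : Matrix (Fin N) (Fin k) ℝ) (V' : Fin M → Matrix (Fin N) (Fin k) ℝ),
      U'ᵀ * U' = 1 →
      ∑ m : Fin M, frobSq (B m - U * (V m)ᵀ)
        ≤ ∑ m : Fin M, frobSq (B m - U' * (V' m)ᵀ) := by
  intro U' V' hU'
  have hsum (X : Matrix (Fin N) (Fin k) ℝ) :
      ∑ m, trace (Xᵀ * (B m * (B m)ᵀ) * X) = trace (Xᵀ * (∑ m, B m * (B m)ᵀ) * X) := by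
    rw [Matrix.mul_sum, Matrix.sum_mul, trace_sum]
  have hmax : trace (U'ᵀ * (∑ m, B m * (B m)ᵀ) * U') ≤
      trace (Uᵀ * (∑ m, B m * (B m)ᵀ) * U) := by
    rw [Matrix.mul_assoc Uᵀ, hUeig, ← Matrix.mul_assoc, hU, Matrix.one_mul, trace_diagonal,
      hdecomp]
    have hW : (Qᵀ * U')ᵀ * (Qᵀ * U') = 1 := by
      rw [transpose_mul, transpose_transpose, Matrix.mul_assoc, ← Matrix.mul_assoc Q,
        mul_eq_one_comm.mp hQ, Matrix.one_mul, hU']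
    simpa only [transpose_mul, transpose_transpose, Matrix.mul_assoc] using
      trace_transpose_mul_diagonal_mul_le hk hlam hW
  have hzero : frobSq (0 : Matrix (Fin N) (Fin k) ℝ) = 0 := by simp [frobSq]
  simp only [frobSq_sub_mul_transpose _ _ _ hU, frobSq_sub_mul_transpose _ _ _ hU', hV, sub_self,
    hzero, add_zero, Finset.sum_add_distrib, Finset.sum_sub_distrib, hsum]
  have hres : 0 ≤ ∑ m, frobSq (V' m - (B m)ᵀ * U') :=
    Finset.sum_nonneg fun m _ => frobSq_nonneg _
  linarith
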